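/- Let μ and ν be Borel probability measures on ℝ, and let V be a random variable on a probability space (Ω, F, P) with distribution μ; suppose (Ω, F, P) admits a uniform random variable on (0,1) independent of V. Let ε > 0 and δ > 0. Then there exists a random variable W on (Ω, F, P) with distribution ν such that P(|V − W| > δ) ≤ ε if and only if μ(A) ≤ ν(A^δ) + ε for every Borel subset A of ℝ. -/

import Mathlib

section

open MeasureTheory ProbabilityTheory
open Filter Topology Set
open scoped ENNReal

lemma Fintype.exists_perm_card_not_rel_le {n k : ℕ} (r : Fin n → Fin n → Prop)
    [∀ i, DecidablePred (r i)]
    (h : ∀ S : Finset (Fin n),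
      S.card ≤ (Finset.univ.filter fun j ↦ ∃ i ∈ S, r i j).card + k) :
    ∃ σ : Equiv.Perm (Fin n), (Finset.univ.filter fun i ↦ ¬ r i (σ i)).card ≤ k := by
  classical
  let t : Fin n → Finset (Fin n ⊕ Fin k) := fun i ↦
    (Finset.univ.filter (r i)).disjSum Finset.univ
  obtain ⟨f, hf, hft⟩ := (Finset.all_card_le_biUnion_card_iff_exists_injective t).1 fun S ↦ by
    rcases S.eq_empty_or_nonempty with rfl | ⟨i₀, hi₀⟩
    · simp
    refine (h S).trans ?_
    have : (Finset.univ.filter fun j ↦ ∃ i ∈ S, r i j).disjSum (Finset.univ : Finset (Fin k))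
        ⊆ S.biUnion t := by
      intro a ha
      rcases a with a | a
      · simpa [t] using ha
      · simpa [t] using ⟨i₀, hi₀⟩
    simpa [Finset.card_disjSum] using Finset.card_le_card this
  let g : Fin n → Fin n := fun i ↦ (f i).elim id fun _ ↦ i
  let s : Finset (Fin n) := Finset.univ.filter fun i ↦ (f i).isLeft
  obtain ⟨e, he⟩ := Finset.exists_equiv_extend_of_card_eq (α := Fin n) (β := Fin n)
    (t := Finset.univ) (by simp) (s := s) (f := g) (by simp) (by
      intro i hi j hj hij
      simp only [s, Finset.coe_filter, Finset.mem_univ, true_and, Set.mem_ofPred_eq,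
        Sum.isLeft_iff] at hi hj
      obtain ⟨a, ha⟩ := hi
      obtain ⟨b, hb⟩ := hj
      apply hf
      simp_all [g])
  let σ : Equiv.Perm (Fin n) := e.trans (Equiv.subtypeUnivEquiv (by simp))
  have hσ : ∀ i ∈ s, r i (σ i) := by
    intro i hi
    have h1 : σ i = g i := he i hi
    obtain ⟨a, ha⟩ := Sum.isLeft_iff.1 (Finset.mem_filter.1 hi).2
    have h2 := hft i
    rw [ha] at h2
    have h3 : g i = a := by simp [g, ha]
    rw [h1, h3]
    simpa [t] using h2
  refine ⟨σ, ?_⟩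
  have : (Finset.univ.filter fun i ↦ ¬ r i (σ i)).card
      ≤ (Finset.univ.image (Sum.inr : Fin k → Fin n ⊕ Fin k)).card := by
    refine Finset.card_le_card_of_injOn f (fun i hi ↦ ?_) hf.injOn
    have hi' : i ∉ s := fun h ↦ (Finset.mem_filter.1 hi).2 (hσ i h)
    have : (f i).isRight := by simpa [s] using hi'
    obtain ⟨b, hb⟩ := Sum.isRight_iff.1 this
    simp [hb]
  refine this.trans (Finset.card_image_le.trans (by simp))

lemma MeasureTheory.exists_continuous_measure_lt_abs_sub_le {X : Measure ℝ} [IsFiniteMeasure X]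
    {f : ℝ → ℝ} (hf : Measurable f) {η : ℝ} (hη : 0 < η) :
    ∃ g : ℝ → ℝ, Continuous g ∧ X {u | η < |f u - g u|} ≤ ENNReal.ofReal η := by
  have hlim : TendstoInMeasure X (fun n u ↦ hf.stronglyMeasurable.approx n u) atTop f :=
    tendstoInMeasure_of_tendsto_ae
      (fun n ↦ (hf.stronglyMeasurable.approx n).measurable.aestronglyMeasurable)
      (ae_of_all _ fun u ↦ hf.stronglyMeasurable.tendsto_approx u)
  have hη2 : 0 < ENNReal.ofReal (η / 2) := by simpa using hη
  obtain ⟨n, hn⟩ := ((hlim _ hη2).eventually (ge_mem_nhds hη2)).exists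
  set s := hf.stronglyMeasurable.approx n
  have hs : Integrable s X := s.integrable_of_isFiniteMeasure
  obtain ⟨g, hg, -⟩ := hs.exists_boundedContinuous_lintegral_sub_le
    (ε := ENNReal.ofReal (η / 2) * ENNReal.ofReal (η / 2)) (by simp [hη])
  refine ⟨g, g.continuous, ?_⟩
  have h1 : X {u | ENNReal.ofReal (η / 2) ≤ ‖s u - g u‖ₑ} ≤ ENNReal.ofReal (η / 2) := by
    have := (mul_meas_ge_le_lintegral₀ (μ := X) (f := fun u ↦ ‖s u - g u‖ₑ)
      (by have := g.continuous.measurable; have := s.measurable; fun_prop)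
      (ENNReal.ofReal (η / 2))).trans hg
    exact (ENNReal.mul_le_mul_iff_right hη2.ne' ENNReal.ofReal_ne_top).1 this
  calc X {u | η < |f u - g u|}
      ≤ X ({u | ENNReal.ofReal (η / 2) ≤ edist (s u) (f u)} ∪
          {u | ENNReal.ofReal (η / 2) ≤ ‖s u - g u‖ₑ}) := by
        refine measure_mono fun u hu ↦ ?_
        by_contra hc
        simp only [mem_union, mem_ofPred_eq, edist_dist, Real.enorm_eq_ofReal_abs, Real.dist_eq,
          not_or, not_le, ENNReal.ofReal_lt_ofReal_iff (half_pos hη)] at hc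
        have := abs_sub_le (f u) (s u) (g u)
        rw [abs_sub_comm (f u) (s u)] at this
        simp only [mem_ofPred_eq] at hu
        linarith [hc.1, hc.2]
    _ ≤ ENNReal.ofReal (η / 2) + ENNReal.ofReal (η / 2) :=
        (measure_union_le _ _).trans (add_le_add hn h1)
    _ = ENNReal.ofReal η := by
        rw [← ENNReal.ofReal_add (by positivity) (by positivity), add_halves]

lemma MeasureTheory.map_projIcc_restrict_Ioc :
    Measure.map (projIcc (0 : ℝ) 1 zero_le_one) (volume.restrict (Ioc 0 1)) =
      (volume : Measure unitInterval) := by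
  rw [Measure.restrict_congr_set Ioc_ae_eq_Icc, ← unitInterval.measurePreserving_coe.map_eq,
    Measure.map_map continuous_projIcc.measurable measurable_subtype_coe]
  convert Measure.map_id
  ext x
  simp

lemma MeasureTheory.Measure.sum_restrict_Ioc_succ (X : Measure ℝ) {a : ℕ → ℝ} (ha : Monotone a)
    (n : ℕ) : ∑ i : Fin n, X.restrict (Ioc (a i) (a (i + 1))) = X.restrict (Ioc (a 0) (a n)) := by
  induction n with
  | zero => simp
  | succ n ih =>
    rw [Fin.sum_univ_castSucc]
    simp only [Fin.val_castSucc, Fin.val_last, ih]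
    rw [← Measure.restrict_union _ measurableSet_Ioc,
      Ioc_union_Ioc_eq_Ioc (ha (Nat.zero_le _)) (ha (Nat.le_succ _))]
    rw [Set.disjoint_left]
    exact fun x hx hx' ↦ hx'.1.not_ge hx.2

lemma MeasureTheory.exists_equal_mass_decomposition (μ : Measure ℝ) [IsProbabilityMeasure μ]
    {η : ℝ} (hη : 0 < η) :
    ∀ᶠ n : ℕ in atTop, ∃ (m : Fin n → Measure ℝ) (x : Fin n → ℝ),
      (∀ i, m i univ = (n : ℝ≥0∞)⁻¹) ∧ ∑ i, m i = μ ∧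
        ∑ i, m i {y | η < |y - x i|} ≤ ENNReal.ofReal η := by
  obtain ⟨f₀, hf₀, hf₀μ⟩ := Measure.exists_measurable_map_eq μ
  have hproj : Measurable (projIcc (0 : ℝ) 1 zero_le_one) := continuous_projIcc.measurable
  let f : ℝ → ℝ := f₀ ∘ projIcc 0 1 zero_le_one
  have hf : Measurable f := hf₀.comp hproj
  have hfμ : Measure.map f (volume.restrict (Ioc 0 1)) = μ := by
    rw [← Measure.map_map hf₀ hproj, map_projIcc_restrict_Ioc, hf₀μ]
  obtain ⟨g, hg, hgf⟩ := exists_continuous_measure_lt_abs_sub_le (X := volume.restrict (Ioc 0 1))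
    hf (half_pos hη)
  obtain ⟨d, hd, hgd⟩ := Metric.uniformContinuousOn_iff.1
    (isCompact_Icc.uniformContinuousOn_of_continuous (hg.continuousOn (s := Icc 0 1)))
    (η / 2) (half_pos hη)
  filter_upwards [eventually_gt_atTop 0,
    (tendsto_inv_atTop_nhds_zero_nat (𝕜 := ℝ)).eventually (gt_mem_nhds hd)] with n hn hnd
  have hn' : (0 : ℝ) < n := by exact_mod_cast hn
  let a : ℕ → ℝ := fun i ↦ i / n
  have ha : Monotone a := fun i j hij ↦ by simp only [a]; gcongr
  have ha_succ (i : ℕ) : a (i + 1) = a i + (n : ℝ)⁻¹ := by simp only [a]; push_cast; ring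
  have ha0 : a 0 = 0 := by simp [a]
  have han : a n = 1 := by simp [a, hn'.ne']
  have hsum := Measure.sum_restrict_Ioc_succ volume ha n
  rw [ha0, han] at hsum
  refine ⟨fun i ↦ Measure.map f (volume.restrict (Ioc (a i) (a (i + 1)))), fun i ↦ g (a i),
    fun i ↦ ?_, ?_, ?_⟩
  · rw [Measure.map_apply hf MeasurableSet.univ, preimage_univ, Measure.restrict_apply_univ,
      Real.volume_Ioc, ha_succ, add_sub_cancel_left, ENNReal.ofReal_inv_of_pos hn',
      ENNReal.ofReal_natCast]
  · rw [← hfμ, ← hsum, Measure.map_finset_sum hf.aemeasurable]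
  · have hmeas (c : ℝ) : MeasurableSet {y : ℝ | η < |y - c|} :=
      measurableSet_lt measurable_const (by fun_prop)
    calc ∑ i : Fin n, Measure.map f (volume.restrict (Ioc (a i) (a (i + 1))))
          {y | η < |y - g (a i)|}
        ≤ ∑ i : Fin n, volume.restrict (Ioc (a i) (a (i + 1))) {u | η / 2 < |f u - g u|} := by
          refine Finset.sum_le_sum fun i _ ↦ ?_
          rw [Measure.map_apply hf (hmeas _), Measure.restrict_apply' measurableSet_Ioc,
            Measure.restrict_apply' measurableSet_Ioc]
          refine measure_mono fun u ⟨hu, hui⟩ ↦ ⟨?_, hui⟩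
          have h0 : 0 ≤ a i := ha0 ▸ ha (Nat.zero_le i)
          have h1 : a (i + 1) ≤ 1 := han ▸ ha i.isLt
          have hdist := hgd u ⟨h0.trans hui.1.le, hui.2.trans h1⟩ (a i)
            ⟨h0, (hui.1.le.trans hui.2).trans h1⟩ (by
              rw [Real.dist_eq, abs_of_pos (sub_pos.2 hui.1)]
              have := hui.2
              rw [ha_succ] at this
              linarith)
          rw [Real.dist_eq] at hdist
          have := abs_sub_le (f u) (g u) (g (a i))
          simp only [mem_preimage, mem_ofPred_eq] at hu ⊢
          linarith
      _ = volume.restrict (Ioc 0 1) {u | η / 2 < |f u - g u|} := by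
          rw [← hsum, Measure.finsetSum_apply]
      _ ≤ ENNReal.ofReal η := hgf.trans (ENNReal.ofReal_le_ofReal (by linarith))

lemma MeasureTheory.exists_measurable_map_prodMk_eq {Ω : Type*} [MeasurableSpace Ω]
    {P : Measure Ω} [IsProbabilityMeasure P] {V U : Ω → ℝ} (hV : Measurable V) (hU : Measurable U)
    (hUunif : Measure.map U P = volume.restrict (Ioo (0 : ℝ) 1)) (hindep : IndepFun V U P)
    (π : Measure (ℝ × ℝ)) [IsProbabilityMeasure π] (hπ : π.fst = Measure.map V P) :
    ∃ W : Ω → ℝ, Measurable W ∧ Measure.map (fun ω ↦ (V ω, W ω)) P = π := by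
  obtain ⟨f, hf, hfκ⟩ := Kernel.exists_measurable_map_eq_unitInterval π.condKernel
  have hproj : Measurable (projIcc (0 : ℝ) 1 zero_le_one) := continuous_projIcc.measurable
  have hmapU : Measure.map (projIcc (0 : ℝ) 1 zero_le_one ∘ U) P = volume := by
    rw [← Measure.map_map hproj hU, hUunif, ← map_projIcc_restrict_Ioc,
      Measure.restrict_congr_set Ioo_ae_eq_Ioc]
  have hU' := hproj.comp hU
  have hlaw : Measure.map (fun ω ↦ (V ω, (projIcc (0 : ℝ) 1 zero_le_one ∘ U) ω)) P =
      π.fst.prod volume := by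
    rw [(indepFun_iff_map_prod_eq_prod_map_map hV.aemeasurable hU'.aemeasurable).1
      (hindep.comp measurable_id hproj), hmapU, hπ]
  have hF : Measurable fun p : ℝ × unitInterval ↦ (p.1, f p.1 p.2) := measurable_fst.prodMk hf
  refine ⟨fun ω ↦ f (V ω) ((projIcc (0 : ℝ) 1 zero_le_one ∘ U) ω),
    hf.comp (hV.prodMk hU'), ?_⟩
  have : (fun ω ↦ (V ω, f (V ω) ((projIcc (0 : ℝ) 1 zero_le_one ∘ U) ω))) =
      (fun p : ℝ × unitInterval ↦ (p.1, f p.1 p.2)) ∘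
        fun ω ↦ (V ω, (projIcc (0 : ℝ) 1 zero_le_one ∘ U) ω) := rfl
  rw [this, ← Measure.map_map hF (hV.prodMk hU'), hlaw]
  conv_rhs => rw [← π.disintegrate π.condKernel]
  ext s hs
  rw [Measure.map_apply hF hs, Measure.prod_apply (hF hs), Measure.compProd_apply hs]
  refine lintegral_congr fun v ↦ ?_
  rw [← hfκ, Measure.map_apply hf.of_uncurry_left (measurable_prodMk_left hs)]
  rfl

lemma card_le_card_add_floor_of_decomposition {μ ν : Measure ℝ} {ε δ η : ℝ} (hε : 0 < ε)
    (hδ : 0 < δ) (hη : 0 < η)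
    (h : ∀ A, MeasurableSet A → μ A ≤ ν (Metric.cthickening δ A) + ENNReal.ofReal ε)
    {n : ℕ} (hn : 0 < n) {m m' : Fin n → Measure ℝ} {x y : Fin n → ℝ}
    (hm : ∀ i, m i univ = (n : ℝ≥0∞)⁻¹) (hmμ : ∑ i, m i = μ)
    (hmx : ∑ i, m i {z | η < |z - x i|} ≤ ENNReal.ofReal η)
    (hm' : ∀ i, m' i univ = (n : ℝ≥0∞)⁻¹) (hmν : ∑ i, m' i = ν)
    (hmy : ∑ i, m' i {z | η < |z - y i|} ≤ ENNReal.ofReal η) (S : Finset (Fin n)) :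
    S.card ≤ (Finset.univ.filter fun j ↦ ∃ i ∈ S, |x i - y j| ≤ δ + 3 * η).card +
      ⌊n * (ε + 2 * η)⌋₊ := by
  classical
  set N := Finset.univ.filter fun j ↦ ∃ i ∈ S, |x i - y j| ≤ δ + 3 * η
  have hn' : (0 : ℝ) < n := by exact_mod_cast hn
  let A : Set ℝ := ⋃ i ∈ S, Metric.closedBall (x i) η
  have hA : MeasurableSet A :=
    Finset.measurableSet_biUnion _ fun _ _ ↦ measurableSet_closedBall
  have h1 : (S.card : ℝ≥0∞) * (n : ℝ≥0∞)⁻¹ ≤ μ A + ENNReal.ofReal η := by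
    calc (S.card : ℝ≥0∞) * (n : ℝ≥0∞)⁻¹ = ∑ i ∈ S, m i univ := by simp [hm]
      _ ≤ ∑ i ∈ S, (m i A + m i {z | η < |z - x i|}) := by
          refine Finset.sum_le_sum fun i hi ↦ (measure_mono ?_).trans (measure_union_le _ _)
          intro z _
          by_cases hz : η < |z - x i|
          · exact Or.inr hz
          · exact Or.inl (mem_biUnion hi (by simpa [Real.dist_eq] using hz))
      _ ≤ ∑ i, (m i A + m i {z | η < |z - x i|}) :=
          Finset.sum_le_sum_of_subset (Finset.subset_univ S)
      _ ≤ μ A + ENNReal.ofReal η := by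
          rw [Finset.sum_add_distrib, ← hmμ, Measure.finsetSum_apply]
          gcongr
  have h2 : ν (Metric.cthickening δ A) ≤ N.card * (n : ℝ≥0∞)⁻¹ + ENNReal.ofReal η := by
    calc ν (Metric.cthickening δ A) = ∑ j, m' j (Metric.cthickening δ A) := by
          rw [← hmν, Measure.finsetSum_apply]
      _ ≤ ∑ j, ((if j ∈ N then (n : ℝ≥0∞)⁻¹ else 0) + m' j {z | η < |z - y j|}) := by
          refine Finset.sum_le_sum fun j _ ↦ ?_
          split_ifs with hj
          · exact ((measure_mono (subset_univ _)).trans (hm' j).le).trans le_self_add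
          · rw [zero_add]
            refine measure_mono fun z hz ↦ ?_
            obtain ⟨b, hb, hzb⟩ := Metric.mem_thickening_iff.1
              (Metric.cthickening_subset_thickening' (δ₂ := δ + η) (by linarith) (by linarith) A hz)
            obtain ⟨i, hi, hbi⟩ := mem_iUnion₂.1 hb
            have hij : δ + 3 * η < |x i - y j| := by
              by_contra hc
              exact hj (Finset.mem_filter.2 ⟨Finset.mem_univ j, i, hi, not_lt.1 hc⟩)
            rw [Metric.mem_closedBall, Real.dist_eq, abs_sub_comm] at hbi
            rw [Real.dist_eq, abs_sub_comm] at hzb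
            have := abs_sub_le (x i) b z
            have := abs_sub_le (x i) z (y j)
            rw [mem_ofPred_eq]
            linarith
      _ ≤ N.card * (n : ℝ≥0∞)⁻¹ + ENNReal.ofReal η := by
          rw [Finset.sum_add_distrib]
          gcongr
          simp
  have h3 : (S.card : ℝ≥0∞) * (n : ℝ≥0∞)⁻¹ ≤
      N.card * (n : ℝ≥0∞)⁻¹ + ENNReal.ofReal (ε + 2 * η) := by
    refine (h1.trans (add_le_add_left ((h A hA).trans (add_le_add_left h2 _)) _)).trans_eq ?_
    rw [two_mul, ENNReal.ofReal_add hε.le (by positivity), ENNReal.ofReal_add hη.le hη.le]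
    ring
  have h4 : (S.card : ℝ) * (n : ℝ)⁻¹ ≤ N.card * (n : ℝ)⁻¹ + (ε + 2 * η) := by
    rw [← ENNReal.ofReal_le_ofReal_iff (by positivity),
      ENNReal.ofReal_add (by positivity) (by positivity), ENNReal.ofReal_mul (by positivity),
      ENNReal.ofReal_mul (by positivity), ENNReal.ofReal_inv_of_pos hn']
    simpa using h3
  have h5 : (S.card : ℝ) ≤ N.card + n * (ε + 2 * η) := by
    have := mul_le_mul_of_nonneg_right h4 hn'.le
    field_simp at this
    linarith
  rw [← tsub_le_iff_left]
  refine Nat.le_floor ?_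
  rcases le_total S.card N.card with hle | hle
  · rw [tsub_eq_zero_of_le hle, Nat.cast_zero]
    positivity
  · rw [Nat.cast_sub hle]
    linarith

lemma exists_coupling_measure_lt_abs_sub_le_add {μ ν : Measure ℝ} [IsProbabilityMeasure μ]
    [IsProbabilityMeasure ν] {ε δ : ℝ} (hε : 0 < ε) (hδ : 0 < δ)
    (h : ∀ A, MeasurableSet A → μ A ≤ ν (Metric.cthickening δ A) + ENNReal.ofReal ε)
    {η : ℝ} (hη : 0 < η) :
    ∃ π : Measure (ℝ × ℝ), π.fst = μ ∧ π.snd = ν ∧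
      π {p | δ + 5 * η < |p.1 - p.2|} ≤ ENNReal.ofReal (ε + 4 * η) := by
  classical
  obtain ⟨n, hn, ⟨m, x, hm, hmμ, hmx⟩, m', y, hm', hmν, hmy⟩ :=
    ((eventually_gt_atTop 0).and ((exists_equal_mass_decomposition μ hη).and
      (exists_equal_mass_decomposition ν hη))).exists
  obtain ⟨τ, hτ⟩ := Fintype.exists_perm_card_not_rel_le (fun i j ↦ |x i - y j| ≤ δ + 3 * η)
    (card_le_card_add_floor_of_decomposition hε hδ hη h hn hm hmμ hmx hm' hmν hmy)
  have hn' : (0 : ℝ) < n := by exact_mod_cast hn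
  have hnc : (n : ℝ≥0∞) * (n : ℝ≥0∞)⁻¹ = 1 :=
    ENNReal.mul_inv_cancel (by exact_mod_cast hn.ne') (ENNReal.natCast_ne_top n)
  have hfin (i) : IsFiniteMeasure (m i) := ⟨by simp [hm, hn]⟩
  have hfin' (i) : IsFiniteMeasure (m' i) := ⟨by simp [hm', hn]⟩
  refine ⟨∑ i, (n : ℝ≥0∞) • (m i).prod (m' (τ i)), ?_, ?_, ?_⟩
  · rw [Measure.fst, Measure.map_finset_sum measurable_fst.aemeasurable, ← hmμ]
    refine Finset.sum_congr rfl fun i _ ↦ ?_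
    rw [Measure.map_smul, Measure.map_fst_prod, hm', smul_smul, hnc, one_smul]
  · rw [Measure.snd, Measure.map_finset_sum measurable_snd.aemeasurable, ← hmν,
      ← Equiv.sum_comp τ m']
    refine Finset.sum_congr rfl fun i _ ↦ ?_
    rw [Measure.map_smul, Measure.map_snd_prod, hm, smul_smul, hnc, one_smul]
  · set B : Set (ℝ × ℝ) := {p | δ + 5 * η < |p.1 - p.2|}
    set bad := Finset.univ.filter fun i ↦ ¬ |x i - y (τ i)| ≤ δ + 3 * η with hbad
    have key (i : Fin n) : (n : ℝ≥0∞) * (m i).prod (m' (τ i)) B ≤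
        (if i ∈ bad then (n : ℝ≥0∞)⁻¹ else 0) +
          (m i {z | η < |z - x i|} + m' (τ i) {z | η < |z - y (τ i)|}) := by
      split_ifs with hi
      · refine le_trans ?_ le_self_add
        calc (n : ℝ≥0∞) * (m i).prod (m' (τ i)) B
            ≤ (n : ℝ≥0∞) * (m i).prod (m' (τ i)) (univ ×ˢ univ) := by
              gcongr
              exact fun _ _ ↦ ⟨trivial, trivial⟩
          _ = (n : ℝ≥0∞)⁻¹ := by
              rw [Measure.prod_prod, hm, hm', ← mul_assoc, hnc, one_mul]
      · have hi' : |x i - y (τ i)| ≤ δ + 3 * η := by simpa [hbad] using hi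
        rw [zero_add]
        calc (n : ℝ≥0∞) * (m i).prod (m' (τ i)) B
            ≤ (n : ℝ≥0∞) * ((m i).prod (m' (τ i)) ({z | η < |z - x i|} ×ˢ univ) +
                (m i).prod (m' (τ i)) (univ ×ˢ {z | η < |z - y (τ i)|})) := by
              gcongr
              refine (measure_mono fun p hp ↦ ?_).trans (measure_union_le _ _)
              by_contra hc
              simp only [mem_union, mem_prod, mem_ofPred_eq, mem_univ, and_true, true_and,
                not_or, not_lt] at hc
              have h1 := abs_sub_le p.1 (x i) p.2
              have h2 := abs_sub_le (x i) (y (τ i)) p.2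
              have h3 := abs_sub_comm (y (τ i)) p.2
              have h4 : δ + 5 * η < |p.1 - p.2| := hp
              linarith [hc.1, hc.2]
          _ = m i {z | η < |z - x i|} + m' (τ i) {z | η < |z - y (τ i)|} := by
              rw [Measure.prod_prod, Measure.prod_prod, hm, hm', mul_add, mul_comm (m i _),
                ← mul_assoc, ← mul_assoc, hnc, one_mul, one_mul]
    calc (∑ i, (n : ℝ≥0∞) • (m i).prod (m' (τ i))) B
        = ∑ i, (n : ℝ≥0∞) * (m i).prod (m' (τ i)) B := by
          simp [Measure.finsetSum_apply]
      _ ≤ bad.card * (n : ℝ≥0∞)⁻¹ + (ENNReal.ofReal η + ENNReal.ofReal η) := by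
          refine (Finset.sum_le_sum fun i _ ↦ key i).trans ?_
          rw [Finset.sum_add_distrib, Finset.sum_add_distrib,
            Equiv.sum_comp τ fun j ↦ m' j {z | η < |z - y j|}]
          gcongr
          simp
      _ ≤ ENNReal.ofReal (ε + 2 * η) + (ENNReal.ofReal η + ENNReal.ofReal η) := by
          gcongr
          have : (bad.card : ℝ) ≤ n * (ε + 2 * η) :=
            (Nat.cast_le.2 hτ).trans (Nat.floor_le (by positivity))
          calc (bad.card : ℝ≥0∞) * (n : ℝ≥0∞)⁻¹
              = ENNReal.ofReal (bad.card * (n : ℝ)⁻¹) := by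
                rw [ENNReal.ofReal_mul (by positivity), ENNReal.ofReal_inv_of_pos hn',
                  ENNReal.ofReal_natCast, ENNReal.ofReal_natCast]
            _ ≤ ENNReal.ofReal (ε + 2 * η) := by
                refine ENNReal.ofReal_le_ofReal ?_
                rw [← div_eq_mul_inv, div_le_iff₀ hn']
                linarith
      _ = ENNReal.ofReal (ε + 4 * η) := by
          rw [← ENNReal.ofReal_add hη.le hη.le, ← ENNReal.ofReal_add (by positivity) (by positivity)]
          ring_nf

lemma exists_coupling_measure_lt_abs_sub_le {μ ν : Measure ℝ} [IsProbabilityMeasure μ]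
    [IsProbabilityMeasure ν] {ε δ : ℝ} (hε : 0 < ε) (hδ : 0 < δ)
    (h : ∀ A, MeasurableSet A → μ A ≤ ν (Metric.cthickening δ A) + ENNReal.ofReal ε) :
    ∃ π : Measure (ℝ × ℝ), π.fst = μ ∧ π.snd = ν ∧
      π {p | δ < |p.1 - p.2|} ≤ ENNReal.ofReal ε := by
  let S : Set (ProbabilityMeasure (ℝ × ℝ)) := {π | (π : Measure (ℝ × ℝ)).fst = μ ∧
    (π : Measure (ℝ × ℝ)).snd = ν}
  have hS_closed : IsClosed S := by
    let μ' : ProbabilityMeasure ℝ := ⟨μ, inferInstance⟩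
    let ν' : ProbabilityMeasure ℝ := ⟨ν, inferInstance⟩
    have : S = {π | π.map (continuous_fst.measurable.aemeasurable) = μ'} ∩
        {π | π.map (continuous_snd.measurable.aemeasurable) = ν'} := by
      ext π
      exact ⟨fun hπ ↦ ⟨Subtype.ext hπ.1, Subtype.ext hπ.2⟩,
        fun hπ ↦ ⟨congrArg Subtype.val hπ.1, congrArg Subtype.val hπ.2⟩⟩
    rw [this]
    exact (isClosed_eq (ProbabilityMeasure.continuous_map continuous_fst) continuous_const).inter
      (isClosed_eq (ProbabilityMeasure.continuous_map continuous_snd) continuous_const)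
  have hS_tight :
      IsTightMeasureSet {((π : ProbabilityMeasure (ℝ × ℝ)) : Measure (ℝ × ℝ)) | π ∈ S} := by
    refine IsTightMeasureSet.prodMk ((isTightMeasureSet_singleton (μ := μ)).subset ?_)
      ((isTightMeasureSet_singleton (μ := ν)).subset ?_)
    · rintro _ ⟨_, ⟨π, hπ, rfl⟩, rfl⟩
      exact hπ.1
    · rintro _ ⟨_, ⟨π, hπ, rfl⟩, rfl⟩
      exact hπ.2
  have hS : IsCompact S := by
    simpa [hS_closed.closure_eq] using isCompact_closure_of_isTightMeasureSet hS_tight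
  obtain ⟨η, hη_anti, hη_pos, hη_lim⟩ := exists_seq_strictAnti_tendsto (0 : ℝ)
  choose π hπμ hπν hπ using fun k ↦
    exists_coupling_measure_lt_abs_sub_le_add hε hδ h (hη_pos k)
  have hprob (k) : IsProbabilityMeasure (π k) := ⟨by
    rw [← Measure.fst_univ, hπμ, measure_univ]⟩
  let π' : ℕ → ProbabilityMeasure (ℝ × ℝ) := fun k ↦ ⟨π k, hprob k⟩
  obtain ⟨ρ, hρ, φ, hφ, hlim⟩ := hS.tendsto_subseq (x := π') fun k ↦ ⟨hπμ k, hπν k⟩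
  have hηφ := hη_lim.comp hφ.tendsto_atTop
  have hbound (d : ℝ) (hd : δ < d) :
      (ρ : Measure (ℝ × ℝ)) {p | d < |p.1 - p.2|} ≤ ENNReal.ofReal ε := by
    have hopen : IsOpen {p : ℝ × ℝ | d < |p.1 - p.2|} :=
      isOpen_lt continuous_const (by fun_prop)
    have hlim_up : Tendsto (fun k ↦ ENNReal.ofReal (ε + 4 * η (φ k))) atTop
        (𝓝 (ENNReal.ofReal ε)) := by
      refine ENNReal.tendsto_ofReal ?_
      simpa using (hηφ.const_mul 4).const_add ε
    have hev : ∀ᶠ k in atTop, π (φ k) {p | d < |p.1 - p.2|} ≤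
        ENNReal.ofReal (ε + 4 * η (φ k)) := by
      have : Tendsto (fun k ↦ δ + 5 * η (φ k)) atTop (𝓝 δ) := by
        simpa using (hηφ.const_mul 5).const_add δ
      filter_upwards [this.eventually (gt_mem_nhds hd)] with k hk
      exact (measure_mono fun p hp ↦ hk.trans hp).trans (hπ (φ k))
    calc (ρ : Measure (ℝ × ℝ)) {p | d < |p.1 - p.2|}
        ≤ liminf (fun k ↦ π (φ k) {p | d < |p.1 - p.2|}) atTop :=
          ProbabilityMeasure.le_liminf_measure_open_of_tendsto hlim hopen
      _ ≤ liminf (fun k ↦ ENNReal.ofReal (ε + 4 * η (φ k))) atTop := liminf_le_liminf hev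
      _ = ENNReal.ofReal ε := hlim_up.liminf_eq
  refine ⟨ρ, hρ.1, hρ.2, ?_⟩
  have hunion : {p : ℝ × ℝ | δ < |p.1 - p.2|} = ⋃ k, {p | δ + η k < |p.1 - p.2|} := by
    ext p
    simp only [mem_ofPred_eq, mem_iUnion]
    refine ⟨fun hp ↦ ?_, fun ⟨k, hk⟩ ↦ by linarith [hη_pos k]⟩
    obtain ⟨k, hk⟩ := (hη_lim.eventually (gt_mem_nhds (sub_pos.2 hp))).exists
    exact ⟨k, by linarith⟩
  have hmono : Monotone fun k ↦ {p : ℝ × ℝ | δ + η k < |p.1 - p.2|} := fun i j hij p hp ↦ by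
    have := hη_anti.antitone hij
    simp only [mem_ofPred_eq] at hp ⊢
    linarith
  rw [hunion, hmono.measure_iUnion]
  exact iSup_le fun k ↦ hbound _ (by linarith [hη_pos k])

end

open MeasureTheory ProbabilityTheory

theorem stmt_17 (μ ν : Measure ℝ) [IsProbabilityMeasure μ] [IsProbabilityMeasure ν]
    (Ω : Type*) [MeasurableSpace Ω] (P : Measure Ω) [IsProbabilityMeasure P]
    (V : Ω → ℝ) (hV : Measurable V) (hVμ : Measure.map V P = μ)
    (U : Ω → ℝ) (hU : Measurable U)
    (hUunif : Measure.map U P = volume.restrict (Set.Ioo (0 : ℝ) 1))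
    (hindep : IndepFun V U P)
    (ε δ : ℝ) (hε : 0 < ε) (hδ : 0 < δ) :
    (∃ W : Ω → ℝ, Measurable W ∧ Measure.map W P = ν ∧
        P {ω | δ < |V ω - W ω|} ≤ ENNReal.ofReal ε) ↔
      ∀ A : Set ℝ, MeasurableSet A →
        μ A ≤ ν (Metric.cthickening δ A) + ENNReal.ofReal ε := by
  constructor
  · rintro ⟨W, hW, rfl, hVW⟩ A hA
    rw [← hVμ, Measure.map_apply hV hA,
      Measure.map_apply hW Metric.isClosed_cthickening.measurableSet]
    calc P (V ⁻¹' A) ≤ P (W ⁻¹' Metric.cthickening δ A ∪ {ω | δ < |V ω - W ω|}) := by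
          refine measure_mono fun ω hω ↦ ?_
          by_cases hd : δ < |V ω - W ω|
          · exact Or.inr hd
          · refine Or.inl (Metric.mem_cthickening_of_dist_le _ (V ω) _ _ hω ?_)
            rw [dist_comm, Real.dist_eq]
            exact not_lt.1 hd
      _ ≤ _ := (measure_union_le _ _).trans (by gcongr)
  · intro h
    obtain ⟨π, hπμ, hπν, hπ⟩ := exists_coupling_measure_lt_abs_sub_le hε hδ h
    have : IsProbabilityMeasure π := ⟨by rw [← Measure.fst_univ, hπμ, measure_univ]⟩
    obtain ⟨W, hW, hlaw⟩ :=
      exists_measurable_map_prodMk_eq hV hU hUunif hindep π (hπμ.trans hVμ.symm)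
    refine ⟨W, hW, ?_, ?_⟩
    · rw [← hπν, ← hlaw, Measure.snd_map_prodMk hV]
    · rw [← hlaw, Measure.map_apply (hV.prodMk hW)
        (measurableSet_lt measurable_const (by fun_prop))] at hπ
      exact hπ
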